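/- Let F be a finite field with q elements, let m be a positive integer, and let A be an m×m matrix over F of rank r. For every j with 0 ≤ j ≤ r, the number N of matrices X in the principal left ideal RA = {B*A : B an m×m matrix over F} with rank X = j satisfies N · ∏_{i=0}^{j−1} (q^j − q^i) = (∏_{i=0}^{j−1} (q^r − q^i)) · (∏_{i=0}^{j−1} (q^m − q^i)). -/

import Mathlib

namespace Matrix

variable {F : Type*} [Field F] {l m n : Type*}

theorem exists_eq_mul_iff_forall_row_mem [Fintype m] (X : Matrix l n F) (A : Matrix m n F) :
    (∃ B : Matrix l m F, X = B * A) ↔ ∀ i, X.row i ∈ Submodule.span F (Set.range A.row) := by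
  simp only [← range_vecMulLinear, LinearMap.mem_range, vecMulLinear_apply]
  constructor
  · rintro ⟨B, rfl⟩ i
    exact ⟨B i, (mul_apply_eq_vecMul B A i).symm⟩
  · intro h
    choose B hB using h
    refine ⟨of B, funext fun i => ?_⟩
    rw [mul_apply_eq_vecMul]
    exact (hB i).symm

theorem exists_eq_mul_of_eq_mul_of_rank_eq [Fintype l] [Fintype m] [Fintype n]
    {U : Matrix l n F} {X : Matrix m n F} (D : Matrix l m F) (hU : U = D * X)
    (h : U.rank = X.rank) : ∃ C : Matrix m l F, X = C * U := by
  have hle : Submodule.span F (Set.range U.row) ≤ Submodule.span F (Set.range X.row) := by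
    rw [Submodule.span_le, Set.range_subset_iff]
    exact (exists_eq_mul_iff_forall_row_mem U X).1 ⟨D, hU⟩
  have heq := Submodule.eq_of_le_of_finrank_eq hle
    (by rwa [← rank_eq_finrank_span_row, ← rank_eq_finrank_span_row])
  rw [exists_eq_mul_iff_forall_row_mem, heq]
  exact fun i => Submodule.subset_span ⟨i, rfl⟩

theorem linearIndependent_row_of_card_le_rank [Fintype m] [Fintype n] (M : Matrix m n F)
    (h : Fintype.card m ≤ M.rank) : LinearIndependent F M.row := by
  rw [linearIndependent_iff_card_le_finrank_span, Set.finrank, ← rank_eq_finrank_span_row]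
  exact h

theorem rank_mul_eq_right_of_linearIndependent_col [Fintype m] [Fintype n]
    (C : Matrix l m F) (U : Matrix m n F) (hC : LinearIndependent F C.col) :
    (C * U).rank = U.rank := by
  have hinj : Function.Injective C.mulVecLin := mulVec_injective_iff.2 hC
  rw [rank, mulVecLin_mul, LinearMap.range_comp]
  exact (Submodule.equivMapOfInjective _ hinj _).finrank_eq.symm

theorem card_linearIndependent_row_eq_mul [Fintype F] [Fintype m] [Fintype n]
    (A : Matrix m n F) {j : ℕ} (hj : j ≤ A.rank) :
    Nat.card {U : Matrix (Fin j) n F //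
        LinearIndependent F U.row ∧ ∃ D : Matrix (Fin j) m F, U = D * A} =
      ∏ i ∈ Finset.range j, (Fintype.card F ^ A.rank - Fintype.card F ^ i) := by
  rw [rank_eq_finrank_span_row] at hj ⊢
  rw [← Fin.prod_univ_eq_prod_range
    (fun i => Fintype.card F ^ _ - Fintype.card F ^ i), ← card_linearIndependent hj]
  refine Nat.card_congr
    { toFun U := ⟨fun i => ⟨U.1.row i, (exists_eq_mul_iff_forall_row_mem _ _).1 U.2.2 i⟩,
        .of_comp (Submodule.subtype _) U.2.1⟩
      invFun u := ⟨of fun i => (u.1 i : n → F),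
        u.2.map' (Submodule.subtype _) (Submodule.ker_subtype _),
        (exists_eq_mul_iff_forall_row_mem _ _).2 fun i => (u.1 i).2⟩
      left_inv _ := rfl
      right_inv _ := rfl }

/-- Rank factorizations `X = C * U` correspond to choices of a basis `U` of the row space of `X`. -/
theorem card_rank_factorizations [Fintype l] [Fintype m] [Fintype n]
    (A : Matrix l n F) (j : ℕ) :
    Nat.card ({C : Matrix m (Fin j) F // LinearIndependent F C.col} ×
      {U : Matrix (Fin j) n F //
        LinearIndependent F U.row ∧ ∃ D : Matrix (Fin j) l F, U = D * A}) =
    Nat.card (Σ X : {X : Matrix m n F // (∃ B : Matrix m l F, X = B * A) ∧ X.rank = j},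
      {U : Matrix (Fin j) n F //
        LinearIndependent F U.row ∧ ∃ D : Matrix (Fin j) m F, U = D * X.1}) := by
  have hrank {U : Matrix (Fin j) n F} (hU : LinearIndependent F U.row) : U.rank = j := by
    simpa using hU.rank_matrix
  refine Nat.card_congr (Equiv.ofBijective (fun p =>
    ⟨⟨p.1.1 * p.2.1, ?_, ?_⟩, ⟨p.2.1, p.2.2.1, ?_⟩⟩) ⟨?_, ?_⟩)
  · obtain ⟨D, hD⟩ := p.2.2.2
    exact ⟨p.1.1 * D, by rw [Matrix.mul_assoc, ← hD]⟩
  · rw [rank_mul_eq_right_of_linearIndependent_col _ _ p.1.2, hrank p.2.2.1]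
  · exact exists_eq_mul_of_eq_mul_of_rank_eq p.1.1 rfl
      (rank_mul_eq_right_of_linearIndependent_col _ _ p.1.2)
  · rintro ⟨⟨C, hC⟩, ⟨U, hU⟩⟩ ⟨⟨C', hC'⟩, ⟨U', hU'⟩⟩ h
    have hX : C * U = C' * U' := congrArg (fun s => s.1.1) h
    have hUU : U = U' := congrArg (fun s => s.2.1) h
    subst hUU
    have hCC : C = C' := by
      funext i
      apply vecMul_injective_iff.2 hU.1
      simpa only [mul_apply_eq_vecMul] using congrFun hX i
    subst hCC
    rfl
  · rintro ⟨⟨X, ⟨B, hB⟩, hX⟩, ⟨U, hU, D, hD⟩⟩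
    dsimp only at hD
    obtain ⟨C, hC⟩ := exists_eq_mul_of_eq_mul_of_rank_eq D hD ((hrank hU).trans hX.symm)
    have hCcol : LinearIndependent F C.col := by
      refine linearIndependent_row_of_card_le_rank Cᵀ ?_
      rw [rank_transpose, Fintype.card_fin]
      exact (hX.symm.trans (congrArg rank hC)).trans_le (rank_mul_le_left C U)
    refine ⟨⟨⟨C, hCcol⟩, ⟨U, hU, D * B, by rw [Matrix.mul_assoc, ← hB, hD]⟩⟩, ?_⟩
    subst hC
    rfl

end Matrix

theorem card_fixed_rank_in_principal_left_ideal_matrix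
    {F : Type*} [Field F] [Fintype F] (q : ℕ) (hq : Fintype.card F = q)
    (m : ℕ) (hm : 0 < m) (A : Matrix (Fin m) (Fin m) F) (r : ℕ) (hr : A.rank = r)
    (j : ℕ) (hj : j ≤ r) :
    Nat.card {X : Matrix (Fin m) (Fin m) F |
        (∃ B : Matrix (Fin m) (Fin m) F, X = B * A) ∧ X.rank = j}
      * ∏ i ∈ Finset.range j, (q ^ j - q ^ i)
    = (∏ i ∈ Finset.range j, (q ^ r - q ^ i)) * ∏ i ∈ Finset.range j, (q ^ m - q ^ i) := by
  classical
  subst hq hr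
  have hcol : Nat.card {C : Matrix (Fin m) (Fin j) F // LinearIndependent F C.col} =
      ∏ i ∈ Finset.range j, (Fintype.card F ^ m - Fintype.card F ^ i) := by
    have hjm : j ≤ Module.finrank F (Fin m → F) := by
      simpa using hj.trans A.rank_le_width
    have h := card_linearIndependent hjm
    rw [Module.finrank_fin_fun, Fin.prod_univ_eq_prod_range
      (fun i => Fintype.card F ^ m - Fintype.card F ^ i)] at h
    rw [← h]
    exact Nat.card_congr
      { toFun C := ⟨C.1.col, C.2⟩
        invFun c := ⟨(Matrix.of c.1).transpose, c.2⟩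
        left_inv _ := rfl
        right_inv _ := rfl }
  have h := Matrix.card_rank_factorizations (m := Fin m) A j
  rw [Nat.card_prod, hcol, Matrix.card_linearIndependent_row_eq_mul A hj, Nat.card_sigma] at h
  rw [mul_comm (∏ i ∈ Finset.range j, (Fintype.card F ^ A.rank - Fintype.card F ^ i)), h,
    Finset.sum_congr rfl fun X _ =>
      (Matrix.card_linearIndependent_row_eq_mul X.1 X.2.2.ge).trans (by rw [X.2.2])]
  simp only [Finset.sum_const, Finset.card_univ, smul_eq_mul, Nat.card_eq_fintype_card]
  rfl
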